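/- arXiv:1511.07549 — 2 statements merged into one kernel-verified Lean document; each statement's English description precedes it below -/
import Mathlib

section
/- Let n ≥ 1, let B : Fin n → Fin n → ℝ∪{−∞} satisfy Tr(B) ≤ 0, let p : Fin n → ℝ∪{−∞} be nonzero, and let q : Fin n → ℝ. Define the real number θ = (1/2)·max over i, j of ((B*)_{ij} + p_j − q_i). Then every vector x : Fin n → ℝ satisfying max_j (B_{ij} + x_j) ≤ x_i for all i has objective value f(x) ≥ θ, and there exists such a vector x with f(x) = θ. -/
open Finset

/-- Tropical (max-plus) matrix powers over `WithBot ℝ`: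
`B⁰ = I` (diagonal `0`, off-diagonal `⊥`), and
`(B^(k+1)) i j = max over l of (B i l + (B^k) l j)`. -/
noncomputable def tropPow {n : ℕ} (B : Fin n → Fin n → WithBot ℝ) :
    ℕ → Fin n → Fin n → WithBot ℝ
  | 0 => fun i j => if i = j then (0 : WithBot ℝ) else ⊥
  | k + 1 => fun i j => Finset.univ.sup fun l => B i l + tropPow B k l j

/-- Kleene star: `(B*) i j = max over 0 ≤ k ≤ n-1 of (B^k) i j`. -/
noncomputable def tropStar {n : ℕ} (B : Fin n → Fin n → WithBot ℝ) (i j : Fin n) : WithBot ℝ :=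
  (Finset.range n).sup fun k => tropPow B k i j

/-- The objective `f(x) = max( max_j (p_j - x_j), max_i (x_i - q_i) )` in `WithBot ℝ`. -/
noncomputable def tropObj {n : ℕ} (p : Fin n → WithBot ℝ) (q x : Fin n → ℝ) : WithBot ℝ :=
  (Finset.univ.sup fun j => p j + ((-(x j) : ℝ) : WithBot ℝ)) ⊔
  (Finset.univ.sup fun i => ((x i - q i : ℝ) : WithBot ℝ))


lemma tp_mul {n : ℕ} (B : Fin n → Fin n → WithBot ℝ) (a b : ℕ) (i c j : Fin n) :
    tropPow B a i c + tropPow B b c j ≤ tropPow B (a + b) i j := by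
  induction a generalizing i with
  | zero =>
    by_cases h : i = c
    · subst h; simp [tropPow]
    · simp [tropPow, h]
  | succ a ih =>
    have : Nonempty (Fin n) := ⟨i⟩
    obtain ⟨l, -, hl⟩ := Finset.exists_mem_eq_sup (univ : Finset (Fin n)) univ_nonempty
      (fun l => B i l + tropPow B a l c)
    have e : tropPow B (a + 1) i c = B i l + tropPow B a l c := hl
    rw [e, show a + 1 + b = (a + b) + 1 by ring, add_assoc]
    calc B i l + (tropPow B a l c + tropPow B b c j)
        ≤ B i l + tropPow B (a + b) l j := by gcongr; exact ih l
      _ ≤ tropPow B (a + b + 1) i j :=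
        Finset.le_sup (f := fun l => B i l + tropPow B (a + b) l j) (mem_univ l)

lemma tp_one {n : ℕ} (B : Fin n → Fin n → WithBot ℝ) (i j : Fin n) :
    B i j ≤ tropPow B 1 i j := by
  have := Finset.le_sup (f := fun l => B i l + tropPow B 0 l j) (mem_univ j)
  simpa [tropPow] using this

lemma tp_walk {n : ℕ} (B : Fin n → Fin n → WithBot ℝ) (k : ℕ) (i j : Fin n) :
    tropPow B k i j = ⊥ ∨ ∃ w : ℕ → Fin n, w 0 = i ∧ w k = j ∧
      tropPow B k i j = ∑ t ∈ range k, B (w t) (w (t + 1)) := by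
  induction k generalizing i with
  | zero =>
    by_cases h : i = j
    · subst h; right; exact ⟨fun _ => i, rfl, rfl, by simp [tropPow]⟩
    · left; simp [tropPow, h]
  | succ k ih =>
    have : Nonempty (Fin n) := ⟨i⟩
    obtain ⟨l, -, hl⟩ := Finset.exists_mem_eq_sup (univ : Finset (Fin n)) univ_nonempty
      (fun l => B i l + tropPow B k l j)
    have e : tropPow B (k + 1) i j = B i l + tropPow B k l j := hl
    rcases ih l with h | ⟨w, h0, hk, hs⟩
    · left; rw [e, h, WithBot.add_bot]
    · right
      refine ⟨fun t => Nat.casesOn t i w, rfl, hk, ?_⟩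
      rw [e, hs, Finset.sum_range_succ']
      simp only [h0]
      exact add_comm _ _

lemma tp_seg {n : ℕ} (B : Fin n → Fin n → WithBot ℝ) (w : ℕ → Fin n) (a d : ℕ) :
    ∑ t ∈ range d, B (w (a + t)) (w (a + t + 1)) ≤ tropPow B d (w a) (w (a + d)) := by
  induction d with
  | zero => simp [tropPow]
  | succ d ih =>
    rw [Finset.sum_range_succ]
    exact (add_le_add ih (tp_one B _ _)).trans (tp_mul B d 1 _ _ _)

lemma tp_le_star {n : ℕ} (B : Fin n → Fin n → WithBot ℝ)
    (hTr : ∀ i : Fin n, ∀ k : ℕ, 1 ≤ k → k ≤ n → tropPow B k i i ≤ 0)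
    (k : ℕ) (hk : k ≤ n) (i j : Fin n) : tropPow B k i j ≤ tropStar B i j := by
  have lt_case : ∀ m, m < n → tropPow B m i j ≤ tropStar B i j := fun m hm =>
    Finset.le_sup (f := fun k => tropPow B k i j) (mem_range.2 hm)
  rcases hk.lt_or_eq with h | rfl
  · exact lt_case k h
  rcases tp_walk B k i j with h | ⟨w, h0, hk', hs⟩
  · rw [h]; exact bot_le
  have hcyc : ∃ a b, a < b ∧ b ≤ k ∧ w a = w b := by
    obtain ⟨a, b, hab, he⟩ := Fintype.exists_ne_map_eq_of_card_lt
      (fun t : Fin (k + 1) => w t) (by simp)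
    have hne : (a : ℕ) ≠ b := fun h => hab (Fin.ext h)
    rcases lt_or_gt_of_ne hne with h | h
    · exact ⟨a, b, h, by omega, he⟩
    · exact ⟨b, a, h, by omega, he.symm⟩
  obtain ⟨a, b, hab, hbk, he⟩ := hcyc
  obtain ⟨d, rfl⟩ := Nat.exists_eq_add_of_le hab.le
  obtain ⟨r, hr⟩ := Nat.exists_eq_add_of_le hbk
  have hsum : tropPow B k i j ≤ tropPow B a (w 0) (w a) +
      tropPow B d (w a) (w (a + d)) + tropPow B r (w (a + d)) (w k) := by
    rw [hs]
    have e : range k = range (a + d + r) := by rw [← hr]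
    rw [e, Finset.sum_range_add, Finset.sum_range_add]
    have h1 := tp_seg B w 0 a
    have h2 := tp_seg B w a d
    have h3 := tp_seg B w (a + d) r
    rw [← hr] at h3
    simp only [zero_add] at h1
    exact add_le_add (add_le_add h1 h2) h3
  rw [← he, h0, hk'] at hsum
  have hc := hTr (w a) d (by omega) (by omega)
  calc tropPow B k i j ≤ _ := hsum
    _ ≤ tropPow B a i (w a) + 0 + tropPow B r (w a) j := by gcongr
    _ = tropPow B a i (w a) + tropPow B r (w a) j := by rw [add_zero]
    _ ≤ tropPow B (a + r) i j := tp_mul B a r _ _ _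
    _ ≤ tropStar B i j := lt_case _ (by omega)

lemma star_mul {n : ℕ} (B : Fin n → Fin n → WithBot ℝ)
    (hTr : ∀ i : Fin n, ∀ k : ℕ, 1 ≤ k → k ≤ n → tropPow B k i i ≤ 0)
    (i l j : Fin n) : tropStar B i l + B l j ≤ tropStar B i j := by
  have hn : (range n).Nonempty := ⟨0, mem_range.2 (by have := i.2; omega)⟩
  obtain ⟨k, hk, e⟩ := Finset.exists_mem_eq_sup (range n) hn (fun k => tropPow B k i l)
  have e' : tropStar B i l = tropPow B k i l := e
  rw [e']
  rw [mem_range] at hk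
  calc _ ≤ tropPow B k i l + tropPow B 1 l j := by gcongr; exact tp_one B l j
    _ ≤ tropPow B (k + 1) i j := tp_mul B k 1 _ _ _
    _ ≤ _ := tp_le_star B hTr (k + 1) hk i j

lemma star_diag {n : ℕ} (B : Fin n → Fin n → WithBot ℝ) (i : Fin n) : 0 ≤ tropStar B i i := by
  have := Finset.le_sup (f := fun k => tropPow B k i i)
    (mem_range.2 (show 0 < n by have := i.2; omega))
  exact (show (0 : WithBot ℝ) ≤ tropPow B 0 i i by simp [tropPow]).trans this

lemma star_feas {n : ℕ} (B : Fin n → Fin n → WithBot ℝ) (x : Fin n → ℝ)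
    (hx : ∀ i j, B i j + ((x j : ℝ) : WithBot ℝ) ≤ ((x i : ℝ) : WithBot ℝ)) (i j : Fin n) :
    tropStar B i j + ((x j : ℝ) : WithBot ℝ) ≤ ((x i : ℝ) : WithBot ℝ) := by
  have hpow : ∀ k i, tropPow B k i j + ((x j : ℝ) : WithBot ℝ) ≤ ((x i : ℝ) : WithBot ℝ) := by
    intro k
    induction k with
    | zero =>
      intro i
      by_cases h : i = j
      · subst h; simp [tropPow]
      · simp [tropPow, h]
    | succ k ih =>
      intro i
      have : Nonempty (Fin n) := ⟨i⟩
      obtain ⟨l, -, hl⟩ := Finset.exists_mem_eq_sup (univ : Finset (Fin n)) univ_nonempty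
        (fun l => B i l + tropPow B k l j)
      have e : tropPow B (k + 1) i j = B i l + tropPow B k l j := hl
      rw [e, add_assoc]
      exact (add_le_add le_rfl (ih l)).trans (hx i l)
  have hn : (range n).Nonempty := ⟨0, mem_range.2 (by have := i.2; omega)⟩
  obtain ⟨k, -, e⟩ := Finset.exists_mem_eq_sup (range n) hn (fun k => tropPow B k i j)
  have e' : tropStar B i j = tropPow B k i j := e
  rw [e']; exact hpow k i

theorem stmt2 {n : ℕ} (hn : 1 ≤ n) (B : Fin n → Fin n → WithBot ℝ)
    (hTr : ∀ i : Fin n, ∀ k : ℕ, 1 ≤ k → k ≤ n → tropPow B k i i ≤ 0)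
    (p : Fin n → WithBot ℝ) (hp : ∃ i, p i ≠ ⊥)
    (q : Fin n → ℝ)
    (θ : ℝ)
    (hθ : (θ : WithBot ℝ) =
      WithBot.map (fun r => r / 2)
        (Finset.univ.sup fun i => Finset.univ.sup fun j =>
          tropStar B i j + p j + ((-(q i) : ℝ) : WithBot ℝ))) :
    (∀ x : Fin n → ℝ,
      (∀ i, (Finset.univ.sup fun j => B i j + ((x j : ℝ) : WithBot ℝ)) ≤ ((x i : ℝ) : WithBot ℝ)) →
      (θ : WithBot ℝ) ≤ tropObj p q x) ∧
    (∃ x : Fin n → ℝ,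
      (∀ i, (Finset.univ.sup fun j => B i j + ((x j : ℝ) : WithBot ℝ)) ≤ ((x i : ℝ) : WithBot ℝ)) ∧
      tropObj p q x = (θ : WithBot ℝ)) := by
  have hne : Nonempty (Fin n) := ⟨⟨0, hn⟩⟩
  set S := (Finset.univ.sup fun i => Finset.univ.sup fun j =>
          tropStar B i j + p j + ((-(q i) : ℝ) : WithBot ℝ)) with hS
  have hS2 : S = ((2 * θ : ℝ) : WithBot ℝ) := by
    clear_value S
    induction S using WithBot.recBotCoe with
    | bot => simp at hθ
    | coe s =>
      rw [WithBot.map_coe, WithBot.coe_inj] at hθ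
      rw [WithBot.coe_inj, hθ]; ring
  have hSle : ∀ i j, tropStar B i j + p j + ((-(q i) : ℝ) : WithBot ℝ) ≤
      ((2 * θ : ℝ) : WithBot ℝ) := by
    intro i j
    rw [← hS2, hS]
    exact (Finset.le_sup (f := fun j => tropStar B i j + p j + ((-(q i) : ℝ) : WithBot ℝ))
      (mem_univ j)).trans (Finset.le_sup (f := fun i => Finset.univ.sup fun j =>
          tropStar B i j + p j + ((-(q i) : ℝ) : WithBot ℝ)) (mem_univ i))
  have lower : ∀ x : Fin n → ℝ,
      (∀ i, (Finset.univ.sup fun j => B i j + ((x j : ℝ) : WithBot ℝ)) ≤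
        ((x i : ℝ) : WithBot ℝ)) → (θ : WithBot ℝ) ≤ tropObj p q x := by
    intro x hx
    have hx' : ∀ i j, B i j + ((x j : ℝ) : WithBot ℝ) ≤ ((x i : ℝ) : WithBot ℝ) := fun i j =>
      (Finset.le_sup (f := fun j => B i j + ((x j : ℝ) : WithBot ℝ)) (mem_univ j)).trans (hx i)
    have h1 : ∀ j, p j + ((-(x j) : ℝ) : WithBot ℝ) ≤ tropObj p q x := fun j =>
      (Finset.le_sup (f := fun j => p j + ((-(x j) : ℝ) : WithBot ℝ)) (mem_univ j)).trans
        le_sup_left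
    have h2 : ∀ i, ((x i - q i : ℝ) : WithBot ℝ) ≤ tropObj p q x := fun i =>
      (Finset.le_sup (f := fun i => ((x i - q i : ℝ) : WithBot ℝ)) (mem_univ i)).trans
        le_sup_right
    generalize tropObj p q x = F at h1 h2
    induction F using WithBot.recBotCoe with
    | bot => simpa using h2 ⟨0, hn⟩
    | coe φ =>
      have key : S ≤ ((2 * φ : ℝ) : WithBot ℝ) := by
        rw [hS]
        refine Finset.sup_le fun i _ => Finset.sup_le fun j _ => ?_
        have hs := star_feas B x hx' i j
        have h1j := h1 j
        have h2i := h2 i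
        generalize tropStar B i j = s at hs
        generalize p j = P at h1j
        induction s using WithBot.recBotCoe with
        | bot => simp
        | coe s =>
          induction P using WithBot.recBotCoe with
          | bot => simp
          | coe P =>
            norm_cast at *
            linarith
      rw [hS2] at key
      norm_cast at *
      linarith
  refine ⟨lower, ?_⟩
  -- finite values in the column minimum
  let g : Fin n → Fin n → WithTop ℝ := fun j i =>
    WithBot.recBotCoe (⊤ : WithTop ℝ) (fun s : ℝ => ((q i + θ - s : ℝ) : WithTop ℝ))
      (tropStar B i j)
  have hx0 : ∀ j, ∃ y : ℝ, (∀ i, tropStar B i j + (y : WithBot ℝ) ≤ ((q i + θ : ℝ) : WithBot ℝ)) ∧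
      ∃ i, tropStar B i j + (y : WithBot ℝ) = ((q i + θ : ℝ) : WithBot ℝ) := by
    intro j
    obtain ⟨i, -, hi⟩ := Finset.exists_min_image univ (g j) univ_nonempty
    have hij : tropStar B i j ≠ ⊥ := by
      intro h
      have h1 := hi j (mem_univ j)
      have h2 := star_diag B j
      simp only [g] at h1
      rw [h] at h1
      revert h1 h2
      generalize tropStar B j j = s
      induction s using WithBot.recBotCoe with
      | bot => simp
      | coe s => simp
    obtain ⟨s, hs⟩ := WithBot.ne_bot_iff_exists.1 hij
    refine ⟨q i + θ - s, fun k => ?_, i, ?_⟩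
    · have h1 := hi k (mem_univ k)
      simp only [g] at h1
      rw [← hs] at h1
      revert h1
      generalize tropStar B k j = t
      induction t using WithBot.recBotCoe with
      | bot => simp
      | coe t =>
        intro h1
        simp only [WithBot.recBotCoe_coe] at h1
        norm_cast at *
        linarith
    · rw [← hs]; norm_cast; ring
  choose x hx1 hx2 using hx0
  have hfeas : ∀ i, (Finset.univ.sup fun j => B i j + ((x j : ℝ) : WithBot ℝ)) ≤
      ((x i : ℝ) : WithBot ℝ) := by
    refine fun i => Finset.sup_le fun j _ => ?_
    obtain ⟨k, hk⟩ := hx2 i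
    have h1 := hx1 j k
    have h2 := star_mul B hTr k i j
    generalize tropStar B k i = s at *
    generalize tropStar B k j = t at *
    generalize B i j = b at *
    induction s using WithBot.recBotCoe with
    | bot => rw [WithBot.bot_add] at hk; exact absurd hk.symm WithBot.coe_ne_bot
    | coe s =>
      induction b using WithBot.recBotCoe with
      | bot => simp
      | coe b =>
        induction t using WithBot.recBotCoe with
        | bot => rw [← WithBot.coe_add] at h2; simp at h2
        | coe t =>
          norm_cast at *
          linarith
  refine ⟨x, hfeas, le_antisymm ?_ (lower x hfeas)⟩
  refine sup_le (Finset.sup_le fun j _ => ?_) (Finset.sup_le fun i _ => ?_)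
  · obtain ⟨k, hk⟩ := hx2 j
    have h1 := hSle k j
    generalize tropStar B k j = s at *
    generalize p j = P at *
    induction s using WithBot.recBotCoe with
    | bot => rw [WithBot.bot_add] at hk; exact absurd hk.symm WithBot.coe_ne_bot
    | coe s =>
      induction P using WithBot.recBotCoe with
      | bot => simp
      | coe P =>
        norm_cast at *
        linarith
  · have h1 := hx1 i i
    have h2 := star_diag B i
    generalize tropStar B i i = s at *
    induction s using WithBot.recBotCoe with
    | bot => simp at h2
    | coe s =>
      norm_cast at *
      linarith
end

section
/- Define θ = (1/2)·max( p1 − q1, p1 − q2 − 2t, p2 − q1 + 2s, p2 − q2 ). Then a point (x1, x2) ∈ ℝ² satisfies s ≤ x1 ≤ t and attains max_j ( w_j + |x1 − r_{1j}| + |x2 − r_{2j}| ) = θ if and only if there exists α ∈ [0,1] such that, with u1 = (1−α)·(p1 − θ) + α·(min(q1, q2 + 2t) + θ) and u2 = (1−α)·(p2 − θ) + α·(min(q1 − 2s, q2) + θ), one has x1 = ( max(u1, u2 + 2s) − max(u1 − 2t, u2) ) / 2 and x2 = ( max(u1, u2 + 2s) + max(u1 − 2t, u2) ) / 2. -/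
theorem seg_exists (l h x : ℝ) (h1 : l ≤ x) (h2 : x ≤ h) :
    ∃ α : ℝ, 0 ≤ α ∧ α ≤ 1 ∧ (1 - α) * l + α * h = x := by
  rcases eq_or_lt_of_le (h1.trans h2) with e | e
  · exact ⟨0, le_rfl, zero_le_one, by linarith⟩
  · have hp : 0 < h - l := by linarith
    refine ⟨(x - l) / (h - l), div_nonneg (by linarith) hp.le, ?_, ?_⟩
    · rw [div_le_one hp]; linarith
    · field_simp
      ring

theorem seg_bounds (l h α : ℝ) (hl : l ≤ h) (h0 : 0 ≤ α) (h1 : α ≤ 1) :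
    l ≤ (1 - α) * l + α * h ∧ (1 - α) * l + α * h ≤ h := by
  constructor
  · nlinarith [mul_nonneg h0 (sub_nonneg.2 hl)]
  · nlinarith [mul_nonneg (sub_nonneg.2 h1) (sub_nonneg.2 hl)]

theorem abs_add_abs_le_iff_four (a b c : ℝ) :
    |a| + |b| ≤ c ↔ a + b ≤ c ∧ a - b ≤ c ∧ -a + b ≤ c ∧ -a - b ≤ c := by
  constructor
  · intro h
    have := le_abs_self a
    have := neg_abs_le a
    have := le_abs_self b
    have := neg_abs_le b
    refine ⟨?_, ?_, ?_, ?_⟩ <;> linarith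
  · rintro ⟨h1, h2, h3, h4⟩
    rcases abs_cases a with ⟨h, _⟩ | ⟨h, _⟩ <;> rcases abs_cases b with ⟨k, _⟩ | ⟨k, _⟩ <;>
      rw [h, k] <;> linarith

theorem stmt15 (m : ℕ) (hm : 1 ≤ m)
    (hne : (Finset.univ : Finset (Fin m)).Nonempty)
    (r1 r2 w : Fin m → ℝ)
    (s t : ℝ) (hst : s ≤ t)
    (p1 p2 q1 q2 : ℝ)
    (hp1 : p1 = Finset.univ.sup' hne fun j => w j + r1 j + r2 j)
    (hp2 : p2 = Finset.univ.sup' hne fun j => w j - r1 j + r2 j)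
    (hq1 : q1 = Finset.univ.inf' hne fun j => -w j + r1 j + r2 j)
    (hq2 : q2 = Finset.univ.inf' hne fun j => -w j - r1 j + r2 j)
    (θ : ℝ)
    (hθ : θ = (1 / 2) * max (max (p1 - q1) (p1 - q2 - 2 * t))
                            (max (p2 - q1 + 2 * s) (p2 - q2))) :
    ∀ x1 x2 : ℝ,
      (s ≤ x1 ∧ x1 ≤ t ∧
       (Finset.univ.sup' hne fun j => w j + |x1 - r1 j| + |x2 - r2 j|) = θ)
      ↔
      (∃ α : ℝ, 0 ≤ α ∧ α ≤ 1 ∧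
        x1 = (max ((1 - α) * (p1 - θ) + α * (min q1 (q2 + 2 * t) + θ))
                   ((1 - α) * (p2 - θ) + α * (min (q1 - 2 * s) q2 + θ) + 2 * s)
              - max ((1 - α) * (p1 - θ) + α * (min q1 (q2 + 2 * t) + θ) - 2 * t)
                   ((1 - α) * (p2 - θ) + α * (min (q1 - 2 * s) q2 + θ))) / 2 ∧
        x2 = (max ((1 - α) * (p1 - θ) + α * (min q1 (q2 + 2 * t) + θ))
                   ((1 - α) * (p2 - θ) + α * (min (q1 - 2 * s) q2 + θ) + 2 * s)
              + max ((1 - α) * (p1 - θ) + α * (min q1 (q2 + 2 * t) + θ) - 2 * t)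
                   ((1 - α) * (p2 - θ) + α * (min (q1 - 2 * s) q2 + θ))) / 2) := by
  intro x1 x2
  have key : ∀ M : ℝ,
      (Finset.univ.sup' hne fun j => w j + |x1 - r1 j| + |x2 - r2 j|) ≤ M ↔
        p1 - M ≤ x1 + x2 ∧ x1 + x2 ≤ q1 + M ∧ p2 - M ≤ x2 - x1 ∧ x2 - x1 ≤ q2 + M := by
    intro M
    have e1 : p1 - M ≤ x1 + x2 ↔ p1 ≤ x1 + x2 + M := by constructor <;> intro h <;> linarith
    have e2 : x1 + x2 ≤ q1 + M ↔ x1 + x2 - M ≤ q1 := by constructor <;> intro h <;> linarith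
    have e3 : p2 - M ≤ x2 - x1 ↔ p2 ≤ x2 - x1 + M := by constructor <;> intro h <;> linarith
    have e4 : x2 - x1 ≤ q2 + M ↔ x2 - x1 - M ≤ q2 := by constructor <;> intro h <;> linarith
    rw [e1, e2, e3, e4, hp1, hp2, hq1, hq2]
    simp only [Finset.sup'_le_iff, Finset.le_inf'_iff, Finset.mem_univ, true_implies]
    have e5 : ∀ j, w j + |x1 - r1 j| + |x2 - r2 j| ≤ M ↔
        |x1 - r1 j| + |x2 - r2 j| ≤ M - w j := by
      intro j; constructor <;> intro h <;> linarith
    simp only [e5, abs_add_abs_le_iff_four]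
    constructor
    · intro h
      refine ⟨fun j => ?_, fun j => ?_, fun j => ?_, fun j => ?_⟩ <;>
        obtain ⟨a, b, c, d⟩ := h j <;> linarith
    · rintro ⟨a, b, c, d⟩ j
      have := a j
      have := b j
      have := c j
      have := d j
      refine ⟨?_, ?_, ?_, ?_⟩ <;> linarith
  clear hp1 hp2 hq1 hq2
  generalize (Finset.univ.sup' hne fun j => w j + |x1 - r1 j| + |x2 - r2 j|) = S at key ⊢
  have g : p1 - q1 ≤ 2 * θ ∧ p1 - q2 - 2 * t ≤ 2 * θ ∧ p2 - q1 + 2 * s ≤ 2 * θ ∧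
      p2 - q2 ≤ 2 * θ := by
    have e : 2 * θ = max (max (p1 - q1) (p1 - q2 - 2 * t))
        (max (p2 - q1 + 2 * s) (p2 - q2)) := by rw [hθ]; ring
    rw [e]; simp
  obtain ⟨g1, g2, g3, g4⟩ := g
  have gc : 2 * θ = p1 - q1 ∨ 2 * θ = p1 - q2 - 2 * t ∨ 2 * θ = p2 - q1 + 2 * s ∨
      2 * θ = p2 - q2 := by
    have e : 2 * θ = max (max (p1 - q1) (p1 - q2 - 2 * t))
        (max (p2 - q1 + 2 * s) (p2 - q2)) := by rw [hθ]; ring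
    rw [e]
    rcases max_choice (max (p1 - q1) (p1 - q2 - 2 * t)) (max (p2 - q1 + 2 * s) (p2 - q2))
      with h | h <;> rw [h]
    · rcases max_choice (p1 - q1) (p1 - q2 - 2 * t) with h | h <;> simp [h]
    · rcases max_choice (p2 - q1 + 2 * s) (p2 - q2) with h | h <;> simp [h]
  clear hθ
  have low : s ≤ x1 → x1 ≤ t → θ ≤ S := by
    intro h1 h2
    obtain ⟨a, b, c, d⟩ := (key S).1 le_rfl
    rcases gc with h | h | h | h <;> linarith
  have hl1 : p1 - θ ≤ min q1 (q2 + 2 * t) + θ := by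
    rcases min_choice q1 (q2 + 2 * t) with h | h <;> rw [h] <;> linarith
  have hl2 : p2 - θ ≤ min (q1 - 2 * s) q2 + θ := by
    rcases min_choice (q1 - 2 * s) q2 with h | h <;> rw [h] <;> linarith
  have m1 := min_le_left q1 (q2 + 2 * t)
  have m2 := min_le_right q1 (q2 + 2 * t)
  have m3 := min_le_left (q1 - 2 * s) q2
  have m4 := min_le_right (q1 - 2 * s) q2
  constructor
  · rintro ⟨hs, ht, hS⟩
    obtain ⟨a, b, c, d⟩ := (key θ).1 hS.le
    have ha : x1 + x2 ≤ min q1 (q2 + 2 * t) + θ := by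
      rcases min_choice q1 (q2 + 2 * t) with h | h <;> rw [h] <;> linarith
    have hb : x2 - x1 ≤ min (q1 - 2 * s) q2 + θ := by
      rcases min_choice (q1 - 2 * s) q2 with h | h <;> rw [h] <;> linarith
    have hex : ∃ α : ℝ, 0 ≤ α ∧ α ≤ 1 ∧
        (1 - α) * (p1 - θ) + α * (min q1 (q2 + 2 * t) + θ) = x1 + x2 ∧
        (1 - α) * (p2 - θ) + α * (min (q1 - 2 * s) q2 + θ) = x2 - x1 := by
      have hd : p1 - θ = min q1 (q2 + 2 * t) + θ ∨ p2 - θ = min (q1 - 2 * s) q2 + θ := by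
        rcases gc with h | h | h | h
        · left; linarith
        · left; linarith
        · right; linarith
        · right; linarith
      rcases hd with h | h
      · obtain ⟨α, h0, h1, e⟩ := seg_exists _ _ _ c hb
        refine ⟨α, h0, h1, ?_, e⟩
        rw [← h]; linarith
      · obtain ⟨α, h0, h1, e⟩ := seg_exists _ _ _ a ha
        refine ⟨α, h0, h1, e, ?_⟩
        rw [← h]; linarith
    obtain ⟨α, h0, h1, e1, e2⟩ := hex
    refine ⟨α, h0, h1, ?_⟩
    rw [e1, e2, max_eq_left (by linarith : x2 - x1 + 2 * s ≤ x1 + x2),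
      max_eq_right (by linarith : x1 + x2 - 2 * t ≤ x2 - x1)]
    constructor <;> ring
  · rintro ⟨α, h0, h1, e1, e2⟩
    obtain ⟨b1, b2⟩ := seg_bounds _ _ α hl1 h0 h1
    obtain ⟨b3, b4⟩ := seg_bounds _ _ α hl2 h0 h1
    generalize (1 - α) * (p1 - θ) + α * (min q1 (q2 + 2 * t) + θ) = u1 at *
    generalize (1 - α) * (p2 - θ) + α * (min (q1 - 2 * s) q2 + θ) = u2 at *
    have hA : x1 + x2 = max u1 (u2 + 2 * s) := by rw [e1, e2]; ring
    have hB : x2 - x1 = max (u1 - 2 * t) u2 := by rw [e1, e2]; ring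
    have n1 := le_max_left u1 (u2 + 2 * s)
    have n2 := le_max_right u1 (u2 + 2 * s)
    have n3 := le_max_left (u1 - 2 * t) u2
    have n4 := le_max_right (u1 - 2 * t) u2
    rw [← hA] at n1 n2
    rw [← hB] at n3 n4
    have cA : x1 + x2 = u1 ∨ x1 + x2 = u2 + 2 * s := by rw [hA]; exact max_choice _ _
    have cB : x2 - x1 = u1 - 2 * t ∨ x2 - x1 = u2 := by rw [hB]; exact max_choice _ _
    have hs : s ≤ x1 := by rcases cB with h | h <;> linarith
    have ht : x1 ≤ t := by rcases cA with h | h <;> linarith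
    refine ⟨hs, ht, le_antisymm ((key θ).2 ⟨?_, ?_, ?_, ?_⟩) (low hs ht)⟩
    · linarith
    · rcases cA with h | h <;> linarith
    · linarith
    · rcases cB with h | h <;> linarith
end
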